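/- Let Ã be a real symmetric n×n matrix and T an invertible real n×n matrix such that Tᵀ Ã T = Λ is diagonal with diagonal entries λ₁,…,λₙ; set Λ⁺ = diag(max(λᵢ,0)), |Λ⁻| = diag(max(−λᵢ,0)), A⁺ = √Λ⁺ · T⁻¹ and A⁻ = √|Λ⁻| · T⁻¹. Let R and S be real n×n matrices such that I − RᵀR is positive definite and I − SᵀS − (RᵀS)ᵀ(I − RᵀR)⁻¹(RᵀS) is positive semidefinite. If a vector U ∈ ℝⁿ satisfies the inhomogeneous boundary condition (A⁻ − R A⁺)U = S G for some data vector G ∈ ℝⁿ, then the boundary term is bounded by the data: Uᵀ Ã U ≥ −‖G‖². -/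

import Mathlib

open Matrix

/-- Euclidean norm of a vector in `ℝⁿ`. -/
noncomputable def eNorm {n : ℕ} (v : Fin n → ℝ) : ℝ :=
  ‖(EuclideanSpace.equiv (Fin n) ℝ).symm v‖

/-- If `1 - RᵀR` is positive definite and its Schur complement in the block matrix of
`‖p‖² + ‖g‖² - ‖R p + S g‖²` is positive semidefinite, then that quadratic form is nonnegative. -/
theorem dotProduct_mulVec_add_mulVec_le {n : ℕ} {R S : Matrix (Fin n) (Fin n) ℝ}
    (hR : (1 - Rᵀ * R).PosDef)
    (hS : (1 - Sᵀ * S - (Rᵀ * S)ᵀ * (1 - Rᵀ * R)⁻¹ * (Rᵀ * S)).PosSemidef)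
    (p g : Fin n → ℝ) :
    (R *ᵥ p + S *ᵥ g) ⬝ᵥ (R *ᵥ p + S *ᵥ g) ≤ p ⬝ᵥ p + g ⬝ᵥ g := by
  have : Invertible (1 - Rᵀ * R) := hR.isUnit.invertible
  have hblock : (fromBlocks (1 - Rᵀ * R) (-(Rᵀ * S)) (-(Rᵀ * S))ᴴ (1 - Sᵀ * S)).PosSemidef := by
    rw [PosDef.fromBlocks₁₁ _ _ hR]
    simpa [conjTranspose_eq_transpose_of_trivial] using hS
  have hnonneg := hblock.dotProduct_mulVec_nonneg (Sum.elim p g)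
  have hadj (P Q : Matrix (Fin n) (Fin n) ℝ) (x y : Fin n → ℝ) :
      x ⬝ᵥ (Pᵀ * Q) *ᵥ y = (P *ᵥ x) ⬝ᵥ (Q *ᵥ y) := by
    rw [← mulVec_mulVec, dotProduct_mulVec, vecMul_transpose]
  simp only [conjTranspose_eq_transpose_of_trivial, transpose_neg, transpose_mul,
    transpose_transpose, star_trivial, fromBlocks_mulVec, sumElim_dotProduct_sumElim,
    Sum.elim_comp_inl, Sum.elim_comp_inr, sub_mulVec, neg_mulVec, one_mulVec, dotProduct_add,
    dotProduct_sub, dotProduct_neg, hadj] at hnonneg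
  rw [add_dotProduct, dotProduct_add, dotProduct_add]
  linarith

/-- A real diagonal quadratic form splits into its positive and negative parts. -/
theorem dotProduct_diagonal_mulVec_eq_sub {n : ℕ} (lam w : Fin n → ℝ) :
    w ⬝ᵥ diagonal lam *ᵥ w =
      (diagonal fun i => √(max (lam i) 0)) *ᵥ w ⬝ᵥ (diagonal fun i => √(max (lam i) 0)) *ᵥ w -
      (diagonal fun i => √(max (-lam i) 0)) *ᵥ w ⬝ᵥ
        (diagonal fun i => √(max (-lam i) 0)) *ᵥ w := by
  simp only [dotProduct, mulVec_diagonal, ← Finset.sum_sub_distrib]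
  refine Finset.sum_congr rfl fun i _ => ?_
  have hpos := Real.mul_self_sqrt (le_max_right (lam i) 0)
  have hneg := Real.mul_self_sqrt (le_max_right (-lam i) 0)
  have hsplit : max (lam i) 0 - max (-lam i) 0 = lam i := max_zero_sub_max_neg_zero_eq_self _
  linear_combination w i ^ 2 * (hneg - hpos - hsplit)

theorem eNorm_sq {n : ℕ} (v : Fin n → ℝ) : eNorm v ^ 2 = v ⬝ᵥ v := by
  rw [eNorm, EuclideanSpace.real_norm_sq_eq]
  simp [dotProduct, ← sq]

/-- strong inhomogeneous nonlinear boundary conditions bound the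
boundary term by the data. -/
theorem strong_inhomogeneous_bc_bound (n : ℕ) (hn : 0 < n)
    (Atil T : Matrix (Fin n) (Fin n) ℝ)
    (hsym : Atil.IsSymm) (hT : IsUnit T.det)
    (lam : Fin n → ℝ) (hdiag : Tᵀ * Atil * T = Matrix.diagonal lam)
    (R S : Matrix (Fin n) (Fin n) ℝ)
    (hR : (1 - Rᵀ * R).PosDef)
    (hS : (1 - Sᵀ * S - (Rᵀ * S)ᵀ * (1 - Rᵀ * R)⁻¹ * (Rᵀ * S)).PosSemidef)
    (U G : Fin n → ℝ)
    (hBC : ((Matrix.diagonal fun i => Real.sqrt (max (-lam i) 0)) * T⁻¹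
            - R * ((Matrix.diagonal fun i => Real.sqrt (max (lam i) 0)) * T⁻¹)).mulVec U
          = S.mulVec G) :
    U ⬝ᵥ Atil.mulVec U ≥ -(eNorm G ^ 2) := by
  have hU : T *ᵥ (T⁻¹ *ᵥ U) = U := by rw [mulVec_mulVec, mul_nonsing_inv T hT, one_mulVec]
  have hform : U ⬝ᵥ Atil *ᵥ U = (T⁻¹ *ᵥ U) ⬝ᵥ diagonal lam *ᵥ (T⁻¹ *ᵥ U) := by
    rw [← hdiag, ← mulVec_mulVec, ← mulVec_mulVec, hU, dotProduct_mulVec _ Tᵀ,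
      vecMul_transpose, hU]
  rw [sub_mulVec, ← mulVec_mulVec, ← mulVec_mulVec, ← mulVec_mulVec, sub_eq_iff_eq_add'] at hBC
  rw [hform, dotProduct_diagonal_mulVec_eq_sub, hBC, eNorm_sq]
  linarith [dotProduct_mulVec_add_mulVec_le hR hS
    ((diagonal fun i => √(max (lam i) 0)) *ᵥ (T⁻¹ *ᵥ U)) G]
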